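/- arXiv:1109.5426 — 2 statements merged into one kernel-verified Lean document; each statement's English description precedes it below -/
import Mathlib

section
/- Let {r_k}_{k∈ℤ} be an absolutely summable sequence of complex numbers with r_{-k} = conj(r_k) for all k, let f(ω) := Σ_{k=-∞}^{∞} r_k e^{-ιkω} (which is real-valued and continuous on [0,2π]), and for each n let Σ_n be the n×n Hermitian Toeplitz matrix with (i,j) entry r_{i-j}, with eigenvalues ζ_1^{(n)},…,ζ_n^{(n)}. Then for every continuous function g : ℝ → ℝ, lim_{n→∞} (1/n) Σ_{i=1}^n g(ζ_i^{(n)}) = (1/2π) ∫_0^{2π} g(f(ω)) dω. -/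
open Filter Matrix

/-- A continuous function on a bounded interval has a modulus of continuity that is quadratic up to
an arbitrarily small error. -/
lemma exists_abs_sub_le_add_mul_sq {g : ℝ → ℝ} (hg : Continuous g) (M : ℝ) {δ : ℝ} (hδ : 0 < δ) :
    ∃ K : ℝ, 0 ≤ K ∧ ∀ x y : ℝ, |x| ≤ M → |y| ≤ M → |g x - g y| ≤ δ + K * (x - y) ^ 2 := by
  have hc : IsCompact (Set.Icc (-M) M) := isCompact_Icc
  obtain ⟨C, hC⟩ := hc.exists_bound_of_continuousOn hg.continuousOn
  obtain ⟨η, hη, h⟩ := Metric.uniformContinuousOn_iff.1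
    (hc.uniformContinuousOn_of_continuous hg.continuousOn) δ hδ
  refine ⟨2 * |C| / η ^ 2, by positivity, fun x y hx hy => ?_⟩
  have hx' : x ∈ Set.Icc (-M) M := abs_le.1 hx
  have hy' : y ∈ Set.Icc (-M) M := abs_le.1 hy
  rcases lt_or_ge |x - y| η with hxy | hxy
  · have := (h x hx' y hy' hxy).le
    rw [Real.dist_eq] at this
    have : 0 ≤ 2 * |C| / η ^ 2 * (x - y) ^ 2 := by positivity
    linarith
  · have h1 : |g x - g y| ≤ 2 * |C| := by
      have := abs_sub (g x) (g y)
      have := hC x hx'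
      have := hC y hy'
      rw [Real.norm_eq_abs] at *
      linarith [le_abs_self C]
    have h2 : η ^ 2 ≤ (x - y) ^ 2 := by
      rw [← sq_abs (x - y)]
      gcongr
    have h3 : 2 * |C| ≤ 2 * |C| / η ^ 2 * (x - y) ^ 2 := by
      rw [div_mul_eq_mul_div, le_div_iff₀ (by positivity)]
      gcongr
    linarith

/-- Spectral expansion of the residual of an approximate eigenvector. -/
lemma Matrix.IsHermitian.sum_sq_eigenvalues_sub_mul_norm_inner {n : Type*} [Fintype n]
    [DecidableEq n] {A : Matrix n n ℂ} (hA : A.IsHermitian) (x : EuclideanSpace ℂ n) (c : ℝ) :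
    ∑ i, (hA.eigenvalues i - c) ^ 2 * ‖inner ℂ (hA.eigenvectorBasis i) x‖ ^ 2 =
      ∑ k, ‖(A *ᵥ x.ofLp) k - c * x k‖ ^ 2 := by
  have key := hA.eigenvectorBasis.sum_sq_norm_inner_right
    (WithLp.toLp 2 (A *ᵥ x.ofLp) - (c : ℂ) • x)
  rw [EuclideanSpace.norm_sq_eq] at key
  simp only [PiLp.sub_apply, PiLp.smul_apply, smul_eq_mul] at key
  rw [← key]
  refine Finset.sum_congr rfl fun i _ => ?_
  have : inner ℂ (hA.eigenvectorBasis i) (WithLp.toLp 2 (A *ᵥ x.ofLp)) =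
      hA.eigenvalues i * inner ℂ (hA.eigenvectorBasis i) x := by
    have hstar (u : n → ℂ) : star u ᵥ* A = star (A *ᵥ u) := by rw [star_mulVec, hA.eq]
    rw [EuclideanSpace.inner_eq_star_dotProduct, EuclideanSpace.inner_eq_star_dotProduct,
      dotProduct_comm, dotProduct_mulVec, hstar, hA.mulVec_eigenvectorBasis,
      dotProduct_comm x.ofLp, star_smul, smul_dotProduct]
    simp
  rw [inner_sub_right, inner_smul_right, this, ← sub_mul, norm_mul, mul_pow, ← Complex.ofReal_sub,
    Complex.norm_real, Real.norm_eq_abs, sq_abs]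

/-- Eigenvalues of a Hermitian matrix are bounded by the largest absolute row sum. -/
lemma Matrix.IsHermitian.abs_eigenvalues_le {n : Type*} [Fintype n] [DecidableEq n]
    {A : Matrix n n ℂ} (hA : A.IsHermitian) {M : ℝ} (hM : ∀ k, ∑ j, ‖A k j‖ ≤ M) (i : n) :
    |hA.eigenvalues i| ≤ M := by
  have hv : Module.End.HasEigenvalue (toLin' A) (hA.eigenvalues i : ℂ) := by
    refine Module.End.hasEigenvalue_of_hasEigenvector
      (x := (hA.eigenvectorBasis i).ofLp) ⟨?_, ?_⟩
    · rw [Module.End.mem_eigenspace_iff, toLin'_apply, hA.mulVec_eigenvectorBasis]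
      ext
      simp
    · intro h
      exact hA.eigenvectorBasis.toBasis.ne_zero i (by ext j; simpa using congrFun h j)
  obtain ⟨k, hk⟩ := eigenvalue_mem_ball hv
  rw [mem_closedBall_iff_norm] at hk
  have h1 := norm_le_norm_add_norm_sub' (hA.eigenvalues i : ℂ) (A k k)
  have h2 := Finset.add_sum_erase Finset.univ (fun j => ‖A k j‖) (Finset.mem_univ k)
  rw [Complex.norm_real, Real.norm_eq_abs] at h1
  linarith [hM k]

lemma integral_exp_int_mul_I (m : ℤ) :
    ∫ ω in (0 : ℝ)..(2 * Real.pi), Complex.exp (Complex.I * m * ω) =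
      if m = 0 then 2 * Real.pi else 0 := by
  split_ifs with hm
  · simp [hm]
  · rw [integral_exp_mul_complex (by simp [hm])]
    have : Complex.exp (Complex.I * m * (2 * Real.pi : ℝ)) = 1 := by
      rw [Complex.exp_eq_one_iff]
      exact ⟨m, by push_cast; ring⟩
    rw [this]
    simp

/-- The vector `(e^{ijω})_{j < n}`. -/
noncomputable def fourierVector (n : ℕ) (ω : ℝ) : EuclideanSpace ℂ (Fin n) :=
  WithLp.toLp 2 fun j => Complex.exp (Complex.I * (j : ℕ) * ω)

lemma norm_exp_I_mul_mul (a ω : ℝ) : ‖Complex.exp (Complex.I * a * ω)‖ = 1 := by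
  rw [mul_assoc, ← Complex.ofReal_mul, mul_comm, Complex.norm_exp_ofReal_mul_I]

lemma norm_fourierVector_sq (n : ℕ) (ω : ℝ) : ‖fourierVector n ω‖ ^ 2 = n := by
  rw [EuclideanSpace.norm_sq_eq]
  have h (j : Fin n) : ‖(fourierVector n ω).ofLp j‖ = 1 := by
    simpa [fourierVector] using norm_exp_I_mul_mul (j : ℕ) ω
  simp [h]

lemma continuous_fourierVector (n : ℕ) : Continuous (fourierVector n) := by
  unfold fourierVector
  fun_prop

/-- Parseval's identity for trigonometric polynomials. -/
lemma integral_norm_inner_fourierVector_sq {n : ℕ} (u : EuclideanSpace ℂ (Fin n)) :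
    ∫ ω in (0 : ℝ)..(2 * Real.pi), ‖inner ℂ u (fourierVector n ω)‖ ^ 2 =
      2 * Real.pi * ‖u‖ ^ 2 := by
  have expand (ω : ℝ) : ((‖inner ℂ u (fourierVector n ω)‖ ^ 2 : ℝ) : ℂ) =
      ∑ j, ∑ k, star (u j) * u k * Complex.exp (Complex.I * ((j : ℤ) - (k : ℤ) : ℤ) * ω) := by
    rw [Complex.ofReal_pow, ← Complex.mul_conj', EuclideanSpace.inner_eq_star_dotProduct]
    simp only [dotProduct, map_sum, Finset.sum_mul_sum]
    refine Finset.sum_congr rfl fun j _ => Finset.sum_congr rfl fun k _ => ?_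
    simp only [fourierVector, Pi.star_apply, map_mul, ← Complex.exp_conj, Complex.conj_I,
      Complex.conj_ofReal, map_natCast, RCLike.star_def, Complex.conj_conj]
    rw [show Complex.I * (((j : ℤ) - (k : ℤ) : ℤ) : ℂ) * ω =
      Complex.I * (j : ℕ) * ω + -Complex.I * (k : ℕ) * ω by push_cast; ring, Complex.exp_add]
    ring
  have hc : ∫ ω in (0 : ℝ)..(2 * Real.pi), ((‖inner ℂ u (fourierVector n ω)‖ ^ 2 : ℝ) : ℂ) =
      ((2 * Real.pi * ‖u‖ ^ 2 : ℝ) : ℂ) := by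
    simp_rw [expand]
    rw [intervalIntegral.integral_finsetSum fun j _ =>
      Continuous.intervalIntegrable (by fun_prop) _ _]
    have inner_sum (j : Fin n) : ∫ ω in (0 : ℝ)..(2 * Real.pi), ∑ k : Fin n,
        star (u j) * u k * Complex.exp (Complex.I * ((j : ℤ) - (k : ℤ) : ℤ) * ω) =
        ∑ k : Fin n, if j = k then star (u j) * u k * (2 * Real.pi) else 0 := by
      rw [intervalIntegral.integral_finsetSum fun k _ =>
        Continuous.intervalIntegrable (by fun_prop) _ _]
      refine Finset.sum_congr rfl fun k _ => ?_
      rw [intervalIntegral.integral_const_mul, integral_exp_int_mul_I]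
      simp only [sub_eq_zero, Nat.cast_inj, Fin.val_inj]
      split_ifs <;> simp
    simp_rw [inner_sum]
    simp only [Finset.sum_ite_eq, Finset.mem_univ, if_true]
    rw [EuclideanSpace.norm_sq_eq, ← Finset.sum_mul]
    push_cast
    rw [mul_comm]
    congr 1
    refine Finset.sum_congr rfl fun j _ => ?_
    rw [← Complex.conj_mul', RCLike.star_def]
  rw [intervalIntegral.integral_ofReal] at hc
  exact_mod_cast hc

/-- The mass of `r` outside of `[-a, a]`. -/
noncomputable def tailMass (r : ℤ → ℂ) (a : ℕ) : ℝ :=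
  ∑' m : ℤ, {m : ℤ | (a : ℤ) < |m|}.indicator (fun m => ‖r m‖) m

lemma tendsto_tailMass {r : ℤ → ℂ} (hsum : Summable fun k => ‖r k‖) :
    Tendsto (tailMass r) atTop (nhds 0) := by
  have := tendsto_tsum_of_dominated_convergence (𝓕 := atTop) (g := fun _ : ℤ => (0 : ℝ))
    (f := fun (a : ℕ) (m : ℤ) => {m : ℤ | (a : ℤ) < |m|}.indicator (fun m => ‖r m‖) m) hsum
    (fun m => ?_) (Eventually.of_forall fun a m => ?_)
  · rwa [tsum_zero] at this
  · refine tendsto_const_nhds.congr' ?_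
    filter_upwards [eventually_ge_atTop m.natAbs] with a ha
    rw [Set.indicator_of_notMem]
    simp only [Set.mem_ofPred_eq, not_lt, abs_le]
    omega
  · exact (norm_indicator_le_norm_self _ _).trans (by simp)

/-- The indices of the entries in row `k` of an `n × n` Toeplitz matrix. -/
def toeplitzRowIndex {n : ℕ} (k : Fin n) : Fin n ↪ ℤ where
  toFun j := (k : ℤ) - (j : ℤ)
  inj' a b h := by
    ext
    simpa using h

lemma toeplitzRowIndex_apply {n : ℕ} (k j : Fin n) :
    toeplitzRowIndex k j = (k : ℤ) - (j : ℤ) := rfl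

/-- Fourier vectors are approximate eigenvectors of Toeplitz matrices. -/
lemma norm_toeplitz_mulVec_sub_le {r : ℤ → ℂ} (hsum : Summable fun k => ‖r k‖) {n : ℕ}
    {A : Matrix (Fin n) (Fin n) ℂ} (hA : ∀ i j : Fin n, A i j = r ((i : ℤ) - (j : ℤ)))
    {c ω : ℝ} (hc : (c : ℂ) = ∑' k : ℤ, r k * Complex.exp (-Complex.I * (k : ℂ) * (ω : ℂ)))
    (k : Fin n) :
    ‖(A *ᵥ (fourierVector n ω).ofLp) k - c * fourierVector n ω k‖ ≤
      tailMass r k + tailMass r (n - 1 - k) := by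
  set G : ℤ → ℂ := fun m => r m * Complex.exp (-Complex.I * (m : ℂ) * (ω : ℂ)) with hG
  have hGn (m : ℤ) : ‖G m‖ = ‖r m‖ := by
    have := norm_exp_I_mul_mul (-m) ω
    rw [hG, norm_mul]
    convert mul_one _ using 2
    convert this using 3
    push_cast
    ring
  have hGs : Summable G := Summable.of_norm (by simpa only [hGn] using hsum)
  have hAx : (A *ᵥ (fourierVector n ω).ofLp) k =
      (∑ m ∈ Finset.univ.map (toeplitzRowIndex k), G m) * fourierVector n ω k := by
    rw [Finset.sum_map, Finset.sum_mul, mulVec, dotProduct]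
    refine Finset.sum_congr rfl fun j _ => ?_
    simp only [hA, fourierVector, hG, toeplitzRowIndex_apply]
    rw [mul_assoc (r _), ← Complex.exp_add]
    congr 2
    push_cast
    ring
  have hnorm : ‖fourierVector n ω k‖ = 1 := by
    simpa [fourierVector] using norm_exp_I_mul_mul (k : ℕ) ω
  have hts (a : ℕ) : HasSum ({m : ℤ | (a : ℤ) < |m|}.indicator (fun m => ‖r m‖)) (tailMass r a) :=
    (hsum.indicator _).hasSum
  rw [hAx, ← sub_mul, norm_mul, hnorm, mul_one, hc,
    ← hGs.sum_add_tsum_compl (s := Finset.univ.map (toeplitzRowIndex k)), sub_add_cancel_left,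
    norm_neg, tsum_subtype _ G]
  refine tsum_of_norm_bounded ((hts k).add (hts (n - 1 - k))) fun m => ?_
  by_cases hm : m ∈ ((Finset.univ.map (toeplitzRowIndex k) : Finset ℤ) : Set ℤ)ᶜ
  · rw [Set.indicator_of_mem hm, hGn]
    have hor : ((k : ℕ) : ℤ) < |m| ∨ ((n - 1 - k : ℕ) : ℤ) < |m| := by
      by_contra! hcon
      refine hm ?_
      have hk := k.2
      simp only [Finset.coe_map, Finset.coe_univ, Set.image_univ, Set.mem_range]
      have := abs_le.1 hcon.1
      have := abs_le.1 hcon.2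
      refine ⟨⟨((k : ℤ) - m).toNat, by omega⟩, ?_⟩
      simp only [toeplitzRowIndex_apply]
      omega
    have hnn (a : ℕ) : 0 ≤ {m : ℤ | (a : ℤ) < |m|}.indicator (fun m => ‖r m‖) m :=
      Set.indicator_nonneg (fun _ _ => norm_nonneg _) _
    rcases hor with h | h
    · have := Set.indicator_of_mem (s := {m : ℤ | ((k : ℕ) : ℤ) < |m|}) h (fun m => ‖r m‖)
      linarith [hnn (n - 1 - k)]
    · have := Set.indicator_of_mem (s := {m : ℤ | ((n - 1 - k : ℕ) : ℤ) < |m|}) h (fun m => ‖r m‖)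
      linarith [hnn k]
  · rw [Set.indicator_of_notMem hm, norm_zero]
    exact add_nonneg (Set.indicator_nonneg (fun _ _ => norm_nonneg _) _)
      (Set.indicator_nonneg (fun _ _ => norm_nonneg _) _)

lemma sum_norm_toeplitz_mulVec_sub_sq_le {r : ℤ → ℂ} (hsum : Summable fun k => ‖r k‖) {n : ℕ}
    {A : Matrix (Fin n) (Fin n) ℂ} (hA : ∀ i j : Fin n, A i j = r ((i : ℤ) - (j : ℤ)))
    {c ω : ℝ} (hc : (c : ℂ) = ∑' k : ℤ, r k * Complex.exp (-Complex.I * (k : ℂ) * (ω : ℂ))) :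
    ∑ k, ‖(A *ᵥ (fourierVector n ω).ofLp) k - c * fourierVector n ω k‖ ^ 2 ≤
      4 * ∑ k ∈ Finset.range n, tailMass r k ^ 2 := by
  calc _ ≤ ∑ k : Fin n, (2 * tailMass r k ^ 2 + 2 * tailMass r (n - 1 - k) ^ 2) := by
        refine Finset.sum_le_sum fun k _ => ?_
        have := pow_le_pow_left₀ (norm_nonneg _) (norm_toeplitz_mulVec_sub_le hsum hA hc k) 2
        nlinarith [sq_nonneg (tailMass r k - tailMass r (n - 1 - k))]
    _ = _ := by
        rw [Fin.sum_univ_eq_sum_range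
          (fun k => 2 * tailMass r k ^ 2 + 2 * tailMass r (n - 1 - k) ^ 2),
          Finset.sum_add_distrib, Finset.sum_range_reflect (fun k => 2 * tailMass r k ^ 2),
          ← Finset.mul_sum]
        ring

lemma sum_norm_toeplitz_row_le {r : ℤ → ℂ} (hsum : Summable fun k => ‖r k‖) {n : ℕ}
    {A : Matrix (Fin n) (Fin n) ℂ} (hA : ∀ i j : Fin n, A i j = r ((i : ℤ) - (j : ℤ)))
    (k : Fin n) : ∑ j, ‖A k j‖ ≤ ∑' m, ‖r m‖ := by
  have := hsum.sum_le_tsum (Finset.univ.map (toeplitzRowIndex k)) fun _ _ => norm_nonneg _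
  simpa [toeplitzRowIndex_apply, hA] using this

/-- Quantitative comparison of the eigenvalues of a Hermitian matrix with a function `f`, given that
the Fourier vector at `ω` is an approximate eigenvector for `f ω`. -/
lemma Matrix.IsHermitian.abs_sum_eigenvalues_sub_integral_le {n : ℕ}
    {A : Matrix (Fin n) (Fin n) ℂ} (hA : A.IsHermitian) {f g : ℝ → ℝ} (hf : Continuous f)
    (hg : Continuous g) {δ K E : ℝ} (hK : 0 ≤ K)
    (hgK : ∀ i ω, |g (hA.eigenvalues i) - g (f ω)| ≤ δ + K * (hA.eigenvalues i - f ω) ^ 2)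
    (hE : ∀ ω, ∑ k, ‖(A *ᵥ (fourierVector n ω).ofLp) k - f ω * fourierVector n ω k‖ ^ 2 ≤ E) :
    |2 * Real.pi * ∑ i, g (hA.eigenvalues i) - n * ∫ ω in (0 : ℝ)..(2 * Real.pi), g (f ω)| ≤
      2 * Real.pi * (n * δ + K * E) := by
  set w : Fin n → ℝ → ℝ := fun i ω => ‖inner ℂ (hA.eigenvectorBasis i) (fourierVector n ω)‖ ^ 2
    with hw
  have hwc (i : Fin n) : Continuous (w i) := by
    have := continuous_fourierVector n
    fun_prop
  have hws (ω : ℝ) : ∑ i, w i ω = n := by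
    rw [hw, hA.eigenvectorBasis.sum_sq_norm_inner_right, norm_fourierVector_sq]
  have hwi (i : Fin n) : ∫ ω in (0 : ℝ)..(2 * Real.pi), w i ω = 2 * Real.pi := by
    rw [hw, integral_norm_inner_fourierVector_sq, hA.eigenvectorBasis.orthonormal.1]
    simp
  have hrep : 2 * Real.pi * ∑ i, g (hA.eigenvalues i) -
      n * ∫ ω in (0 : ℝ)..(2 * Real.pi), g (f ω) =
      ∫ ω in (0 : ℝ)..(2 * Real.pi), ∑ i, (g (hA.eigenvalues i) - g (f ω)) * w i ω := by
    have h (ω : ℝ) : ∑ i, (g (hA.eigenvalues i) - g (f ω)) * w i ω =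
        ∑ i, g (hA.eigenvalues i) * w i ω - n * g (f ω) := by
      simp only [sub_mul, Finset.sum_sub_distrib, ← Finset.mul_sum, hws]
      ring
    simp_rw [h]
    rw [intervalIntegral.integral_sub (Continuous.intervalIntegrable (by fun_prop) _ _)
      (Continuous.intervalIntegrable (by fun_prop) _ _), intervalIntegral.integral_finsetSum
      fun i _ => Continuous.intervalIntegrable (by fun_prop) _ _]
    simp only [intervalIntegral.integral_const_mul, hwi, ← Finset.sum_mul]
    ring
  have hbound (ω : ℝ) : ‖∑ i, (g (hA.eigenvalues i) - g (f ω)) * w i ω‖ ≤ n * δ + K * E := by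
    calc _ ≤ ∑ i, (δ + K * (hA.eigenvalues i - f ω) ^ 2) * w i ω := by
          refine norm_sum_le_of_le _ fun i _ => ?_
          have hnn : 0 ≤ w i ω := sq_nonneg _
          rw [Real.norm_eq_abs, abs_mul, abs_of_nonneg hnn]
          exact mul_le_mul_of_nonneg_right (hgK i ω) hnn
      _ = n * δ + K * ∑ i, (hA.eigenvalues i - f ω) ^ 2 * w i ω := by
          simp only [add_mul, Finset.sum_add_distrib, ← Finset.mul_sum, hws, mul_assoc]
          ring
      _ ≤ _ := by
          rw [hA.sum_sq_eigenvalues_sub_mul_norm_inner]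
          gcongr
          exact hE ω
  rw [hrep, ← Real.norm_eq_abs]
  refine (intervalIntegral.norm_integral_le_of_norm_le_const fun ω _ => hbound ω).trans_eq ?_
  rw [sub_zero, abs_of_pos Real.two_pi_pos, mul_comm]

/-- Toeplitz distribution (Szegő) theorem: for an absolutely summable Hermitian
autocovariance sequence with spectrum `f`, the eigenvalue distribution of the
`n × n` Toeplitz matrices converges to the distribution of `f`. -/
theorem toeplitz_distribution_theorem
    (r : ℤ → ℂ) (hsum : Summable fun k => ‖r k‖)
    (hconj : ∀ k : ℤ, r (-k) = starRingEnd ℂ (r k))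
    (f : ℝ → ℝ)
    (hf : ∀ ω : ℝ, (f ω : ℂ) = ∑' k : ℤ, r k * Complex.exp (-Complex.I * (k : ℂ) * (ω : ℂ)))
    (T : (n : ℕ) → Matrix (Fin n) (Fin n) ℂ)
    (hT : ∀ (n : ℕ) (i j : Fin n), T n i j = r ((i : ℤ) - (j : ℤ)))
    (hHerm : ∀ n : ℕ, (T n).IsHermitian)
    (g : ℝ → ℝ) (hg : Continuous g) :
    Tendsto
      (fun n : ℕ => (1 / (n : ℝ)) * ∑ i : Fin n, g ((hHerm n).eigenvalues i))
      atTop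
      (nhds ((1 / (2 * Real.pi)) * ∫ ω in (0:ℝ)..(2 * Real.pi), g (f ω))) := by
  set M := ∑' m, ‖r m‖ with hM
  have hterm (m : ℤ) (ω : ℝ) :
      ‖r m * Complex.exp (-Complex.I * (m : ℂ) * (ω : ℂ))‖ ≤ ‖r m‖ := by
    have h := norm_exp_I_mul_mul (-m) ω
    rw [norm_mul, show -Complex.I * (m : ℂ) * (ω : ℂ) = Complex.I * ((-m : ℝ) : ℂ) * ω by
      push_cast; ring, h, mul_one]
  have hfc : Continuous f := by
    have h : Continuous fun ω => (f ω : ℂ) := by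
      simp_rw [hf]
      exact continuous_tsum (fun m => by fun_prop) hsum hterm
    exact Complex.continuous_re.comp h
  have hfM (ω : ℝ) : |f ω| ≤ M := by
    rw [← Real.norm_eq_abs, ← Complex.norm_real, hf]
    exact tsum_of_norm_bounded hsum.hasSum fun m => hterm m ω
  have hces : Tendsto (fun n : ℕ => (n : ℝ)⁻¹ * ∑ k ∈ Finset.range n, tailMass r k ^ 2)
      atTop (nhds 0) := by
    simpa using ((tendsto_tailMass hsum).pow 2).cesaro
  rw [Metric.tendsto_nhds]
  intro ε hε
  obtain ⟨K, hK, hgK⟩ := exists_abs_sub_le_add_mul_sq hg M (half_pos hε)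
  have hsmall : ∀ᶠ n : ℕ in atTop,
      4 * K * ((n : ℝ)⁻¹ * ∑ k ∈ Finset.range n, tailMass r k ^ 2) < ε / 2 := by
    have h := hces.const_mul (4 * K)
    rw [mul_zero] at h
    exact h.eventually_lt_const (half_pos hε)
  filter_upwards [hsmall, eventually_gt_atTop 0] with n hn hn0
  have key := (hHerm n).abs_sum_eigenvalues_sub_integral_le hfc hg hK
    (fun i ω => hgK _ _
      ((hHerm n).abs_eigenvalues_le (sum_norm_toeplitz_row_le hsum (hT n)) i) (hfM ω))
    (fun ω => sum_norm_toeplitz_mulVec_sub_sq_le hsum (hT n) (hf ω))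
  have hn' : (0 : ℝ) < n := by exact_mod_cast hn0
  have hpi := Real.pi_pos
  set S := ∑ i, g ((hHerm n).eigenvalues i)
  set J := ∫ ω in (0 : ℝ)..(2 * Real.pi), g (f ω)
  set Q := ∑ k ∈ Finset.range n, tailMass r k ^ 2
  have heq : 1 / (n : ℝ) * S - 1 / (2 * Real.pi) * J =
      (2 * Real.pi * S - n * J) / (2 * Real.pi * n) := by
    field_simp
  rw [Real.dist_eq, heq, abs_div, abs_of_pos (by positivity : 0 < 2 * Real.pi * (n : ℝ))]
  calc _ ≤ 2 * Real.pi * (n * (ε / 2) + K * (4 * Q)) / (2 * Real.pi * n) := by gcongr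
    _ = ε / 2 + 4 * K * ((n : ℝ)⁻¹ * Q) := by field_simp
    _ < ε := by linarith
end

section
/- Let {r_k}_{k∈ℤ} be an absolutely summable sequence of complex numbers with r_{-k} = conj(r_k) for all k, let f(ω) := Σ_{k=-∞}^{∞} r_k e^{-ιkω}, and suppose there is δ > 0 with f(ω) ≥ δ for all ω ∈ [0,2π]. For each n let Σ_n be the n×n Hermitian Toeplitz matrix with (i,j) entry r_{i-j}. Then Σ_n is positive definite for every n and lim_{n→∞} (1/n) log det(Σ_n) = (1/2π) ∫_0^{2π} log f(ω) dω. -/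
open Filter Matrix ComplexOrder

/-- The vector `(exp (ι k ω))_{k < n}`. -/
noncomputable def trigVec (n : ℕ) (ω : ℝ) : Fin n → ℂ :=
  fun i => Complex.exp (Complex.I * (i : ℤ) * ω)

/-- The squared modulus of the trigonometric polynomial with coefficients `star v`. -/
noncomputable def trigWeight {n : ℕ} (v : Fin n → ℂ) (ω : ℝ) : ℝ :=
  Complex.normSq (star v ⬝ᵥ trigVec n ω)

lemma continuous_trigWeight {n : ℕ} (v : Fin n → ℂ) : Continuous (trigWeight v) := by
  unfold trigWeight trigVec dotProduct
  refine Complex.continuous_normSq.comp ?_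
  fun_prop

lemma trigWeight_nonneg {n : ℕ} (v : Fin n → ℂ) (ω : ℝ) : 0 ≤ trigWeight v ω :=
  Complex.normSq_nonneg _

lemma star_trigVec_apply (n : ℕ) (ω : ℝ) (i : Fin n) :
    star (trigVec n ω i) = Complex.exp (-(Complex.I * (i : ℤ) * ω)) := by
  simp [trigVec, ← Complex.exp_conj]

lemma star_dotProduct_trigVec_self (n : ℕ) (ω : ℝ) :
    star (trigVec n ω) ⬝ᵥ trigVec n ω = n := by
  simp only [dotProduct, Pi.star_apply, star_trigVec_apply]
  simp [trigVec, ← Complex.exp_add]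

lemma ofReal_trigWeight {n : ℕ} (v : Fin n → ℂ) (ω : ℝ) :
    (trigWeight v ω : ℂ) = ∑ i : Fin n, ∑ j : Fin n, star (v i) * v j *
      Complex.exp (Complex.I * ((i : ℤ) - (j : ℤ) : ℤ) * ω) := by
  rw [trigWeight, ← Complex.mul_conj, dotProduct, map_sum, Finset.sum_mul_sum]
  refine Finset.sum_congr rfl fun i _ => Finset.sum_congr rfl fun j _ => ?_
  have h := star_trigVec_apply n ω j
  simp only [Complex.star_def] at h
  rw [map_mul, h, trigVec]
  simp only [Pi.star_apply, Complex.star_def, Complex.conj_conj]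
  rw [mul_mul_mul_comm, ← Complex.exp_add]
  push_cast
  ring_nf

/-- A Toeplitz quadratic form is the integral of the symbol against `trigWeight`. -/
lemma integral_mul_trigWeight {n : ℕ} {g : ℝ → ℝ} (hg : Continuous g) {c : ℤ → ℂ}
    (hc : ∀ m : ℤ, ∫ ω in (0:ℝ)..(2 * Real.pi), (g ω : ℂ) * Complex.exp (Complex.I * m * ω)
      = 2 * Real.pi * c m)
    {A : Matrix (Fin n) (Fin n) ℂ} (hA : ∀ i j : Fin n, A i j = c ((i : ℤ) - (j : ℤ)))
    (v : Fin n → ℂ) :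
    ((∫ ω in (0:ℝ)..(2 * Real.pi), g ω * trigWeight v ω : ℝ) : ℂ)
      = 2 * Real.pi * (star v ⬝ᵥ A *ᵥ v) := by
  have key : ∀ ω : ℝ, ((g ω * trigWeight v ω : ℝ) : ℂ) = ∑ i : Fin n, ∑ j : Fin n,
      star (v i) * v j *
        ((g ω : ℂ) * Complex.exp (Complex.I * ((i : ℤ) - (j : ℤ) : ℤ) * ω)) := by
    intro ω
    rw [Complex.ofReal_mul, ofReal_trigWeight, Finset.mul_sum]
    refine Finset.sum_congr rfl fun i _ => ?_
    rw [Finset.mul_sum]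
    exact Finset.sum_congr rfl fun j _ => by ring
  rw [← intervalIntegral.integral_ofReal]
  simp_rw [key]
  rw [intervalIntegral.integral_finsetSum
    fun i _ => Continuous.intervalIntegrable (by fun_prop) _ _]
  simp only [dotProduct, mulVec, Finset.mul_sum]
  refine Finset.sum_congr rfl fun i _ => ?_
  rw [intervalIntegral.integral_finsetSum
    fun i _ => Continuous.intervalIntegrable (by fun_prop) _ _]
  refine Finset.sum_congr rfl fun j _ => ?_
  rw [intervalIntegral.integral_const_mul, hc, hA]
  simp only [Pi.star_apply]
  ring

lemma integral_exp_I_mul_int (m : ℤ) :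
    ∫ ω in (0:ℝ)..(2 * Real.pi), Complex.exp (Complex.I * m * ω)
      = 2 * Real.pi * if m = 0 then 1 else 0 := by
  split_ifs with h
  · simp [h]
  · rw [integral_exp_mul_complex (by simp [h])]
    have : Complex.exp (Complex.I * m * (2 * Real.pi : ℝ)) = 1 := by
      rw [Complex.exp_eq_one_iff]
      exact ⟨m, by push_cast; ring⟩
    rw [this]
    simp

lemma integral_trigWeight {n : ℕ} {v : Fin n → ℂ} (hv : star v ⬝ᵥ v = 1) :
    ∫ ω in (0:ℝ)..(2 * Real.pi), trigWeight v ω = 2 * Real.pi := by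
  have h := integral_mul_trigWeight (n := n) (g := fun _ => 1) continuous_const
    (c := fun m => if m = 0 then 1 else 0) (fun m => by simpa using integral_exp_I_mul_int m)
    (A := 1) (fun i j => by
      simp [Matrix.one_apply, Fin.ext_iff, sub_eq_zero]) v
  rw [one_mulVec, hv] at h
  simp only [one_mul, mul_one] at h
  exact_mod_cast h

lemma star_dotProduct_mul_diagonal_mulVec {ι : Type*} [Fintype ι] [DecidableEq ι]
    (U : Matrix ι ι ℂ) (d : ι → ℝ) (x : ι → ℂ) :
    star x ⬝ᵥ (U * diagonal (fun i => (d i : ℂ)) * star U) *ᵥ x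
      = ((∑ j, d j * Complex.normSq (star (fun i => U i j) ⬝ᵥ x) : ℝ) : ℂ) := by
  have hx : star x ᵥ* U = star (star U *ᵥ x) := by
    rw [star_mulVec, star_eq_conjTranspose, conjTranspose_conjTranspose]
  rw [← mulVec_mulVec, ← mulVec_mulVec, dotProduct_mulVec, hx, dotProduct]
  push_cast
  refine Finset.sum_congr rfl fun j _ => ?_
  have hj : (star U *ᵥ x) j = star (fun i => U i j) ⬝ᵥ x := rfl
  rw [mulVec_diagonal, Pi.star_apply, hj, Complex.normSq_eq_conj_mul_self, Complex.star_def]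
  ring

lemma Matrix.IsHermitian.star_dotProduct_mulVec_eq_sum {ι : Type*} [Fintype ι] [DecidableEq ι]
    {A : Matrix ι ι ℂ} (hA : A.IsHermitian) (x : ι → ℂ) :
    star x ⬝ᵥ A *ᵥ x = ((∑ j, hA.eigenvalues j *
      Complex.normSq (star (hA.eigenvectorBasis j : ι → ℂ) ⬝ᵥ x) : ℝ) : ℂ) := by
  have h := star_dotProduct_mul_diagonal_mulVec (hA.eigenvectorUnitary : Matrix ι ι ℂ)
    hA.eigenvalues x
  have hs := hA.spectral_theorem
  rw [Unitary.conjStarAlgAut_apply] at hs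
  conv_lhs => rw [hs]
  exact h

lemma Matrix.IsHermitian.star_dotProduct_self_eq_sum {ι : Type*} [Fintype ι] [DecidableEq ι]
    {A : Matrix ι ι ℂ} (hA : A.IsHermitian) (x : ι → ℂ) :
    star x ⬝ᵥ x = ((∑ j,
      Complex.normSq (star (hA.eigenvectorBasis j : ι → ℂ) ⬝ᵥ x) : ℝ) : ℂ) := by
  have h := star_dotProduct_mul_diagonal_mulVec (hA.eigenvectorUnitary : Matrix ι ι ℂ)
    (fun _ => 1) x
  simpa using h

lemma Matrix.IsHermitian.star_eigenvectorBasis_dotProduct_self {ι : Type*} [Fintype ι]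
    [DecidableEq ι] {A : Matrix ι ι ℂ} (hA : A.IsHermitian) (j : ι) :
    star (hA.eigenvectorBasis j : ι → ℂ) ⬝ᵥ (hA.eigenvectorBasis j : ι → ℂ) = 1 := by
  rw [dotProduct_comm, ← EuclideanSpace.inner_eq_star_dotProduct]
  simp [inner_self_eq_norm_sq_to_K]

/-- The tails `∑_{|k| > m} ‖r k‖`. -/
noncomputable def normTail (r : ℤ → ℂ) (m : ℕ) : ℝ :=
  ∑' k : ℤ, if m < k.natAbs then ‖r k‖ else 0

lemma summable_normTail {r : ℤ → ℂ} (hsum : Summable fun k => ‖r k‖) (m : ℕ) :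
    Summable fun k : ℤ => if m < k.natAbs then ‖r k‖ else 0 :=
  hsum.of_nonneg_of_le (fun k => by split_ifs <;> simp) (fun k => by split_ifs <;> simp)

lemma tendsto_normTail {r : ℤ → ℂ} (hsum : Summable fun k => ‖r k‖) :
    Tendsto (normTail r) atTop (nhds 0) := by
  have h := tendsto_tsum_of_dominated_convergence (𝓕 := atTop)
    (f := fun (m : ℕ) (k : ℤ) => if m < k.natAbs then ‖r k‖ else 0) (g := fun _ => 0) hsum
    (fun k => tendsto_const_nhds.congr' ?_) (Eventually.of_forall fun m k => ?_)
  · rw [tsum_zero] at h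
    exact h
  · filter_upwards [eventually_ge_atTop k.natAbs] with m hm
    simp [hm.not_gt]
  · split_ifs <;> simp

lemma norm_tsum_sub_sum_le_normTail {r g : ℤ → ℂ} (hsum : Summable fun k => ‖r k‖)
    (hg : ∀ k, ‖g k‖ = ‖r k‖) (n : ℕ) (i : Fin n) :
    ‖∑' k, g k - ∑ j : Fin n, g ((i : ℤ) - (j : ℤ))‖
      ≤ normTail r i + normTail r (n - 1 - i) := by
  have hgs : Summable g := .of_norm (by simpa only [hg] using hsum)
  let e : Fin n ↪ ℤ := ⟨fun j => (i : ℤ) - (j : ℤ), fun a b h => by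
    simp only at h; omega⟩
  have hS : ∑ j : Fin n, g ((i : ℤ) - (j : ℤ)) = ∑ k ∈ Finset.univ.map e, g k := by
    rw [Finset.sum_map]
    rfl
  have hmem : ∀ k : ℤ, k ∉ Finset.univ.map e → (i : ℕ) < k.natAbs ∨ n - 1 - i < k.natAbs := by
    intro k hk
    by_contra! h
    have hi := i.2
    refine hk (Finset.mem_map.2 ⟨⟨((i : ℤ) - k).toNat, by omega⟩, Finset.mem_univ _, ?_⟩)
    change (i : ℤ) - (((i : ℤ) - k).toNat : ℤ) = k
    omega
  rw [hS, sub_eq_of_eq_add' (hgs.sum_add_tsum_compl (s := Finset.univ.map e)).symm,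
    tsum_subtype, normTail, normTail,
    ← (summable_normTail hsum _).tsum_add (summable_normTail hsum _)]
  refine tsum_of_norm_bounded
    ((summable_normTail hsum _).add (summable_normTail hsum _)).hasSum fun k => ?_
  by_cases hk : k ∈ Finset.univ.map e
  · rw [Set.indicator_of_notMem (by simpa using hk), norm_zero]
    positivity
  · rw [Set.indicator_of_mem (by simpa using hk), hg]
    rcases hmem k hk with h | h <;> simp only [h, if_true] <;> split_ifs <;> simp

/-- The Cesàro means of the tails, which bound the Fejér approximation error. -/
lemma tendsto_normTail_average {r : ℤ → ℂ} (hsum : Summable fun k => ‖r k‖) :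
    Tendsto (fun n : ℕ => (n : ℝ)⁻¹ * ∑ i : Fin n, (normTail r i + normTail r (n - 1 - i)))
      atTop (nhds 0) := by
  have h := (tendsto_normTail hsum).cesaro.const_mul 2
  rw [mul_zero] at h
  refine h.congr fun n => ?_
  rw [Finset.sum_add_distrib, Fin.sum_univ_eq_sum_range (normTail r),
    Fin.sum_univ_eq_sum_range (fun i => normTail r (n - 1 - i)), Finset.sum_range_reflect]
  ring

section Symbol

variable {r : ℤ → ℂ} {f : ℝ → ℝ}

lemma norm_fourierTerm (r : ℤ → ℂ) (ω : ℝ) (k : ℤ) :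
    ‖r k * Complex.exp (-Complex.I * (k : ℂ) * (ω : ℂ))‖ = ‖r k‖ := by
  rw [norm_mul, Complex.norm_exp]
  simp

lemma continuous_symbol (hsum : Summable fun k => ‖r k‖)
    (hf : ∀ ω : ℝ, (f ω : ℂ) = ∑' k : ℤ, r k * Complex.exp (-Complex.I * (k : ℂ) * (ω : ℂ))) :
    Continuous f := by
  have h : Continuous fun ω : ℝ =>
      ∑' k : ℤ, r k * Complex.exp (-Complex.I * (k : ℂ) * (ω : ℂ)) :=
    continuous_tsum (fun k => by fun_prop) hsum fun k ω => (norm_fourierTerm r ω k).le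
  simp_rw [← hf] at h
  exact Complex.continuous_re.comp h

lemma integral_symbol_mul_exp (hsum : Summable fun k => ‖r k‖)
    (hf : ∀ ω : ℝ, (f ω : ℂ) = ∑' k : ℤ, r k * Complex.exp (-Complex.I * (k : ℂ) * (ω : ℂ)))
    (m : ℤ) :
    ∫ ω in (0:ℝ)..(2 * Real.pi), (f ω : ℂ) * Complex.exp (Complex.I * m * ω)
      = 2 * Real.pi * r m := by
  have hterm : ∀ (k : ℤ) (ω : ℝ), r k * Complex.exp (-Complex.I * (k : ℂ) * (ω : ℂ)) *
      Complex.exp (Complex.I * m * ω) = r k * Complex.exp (Complex.I * (m - k : ℤ) * ω) := by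
    intro k ω
    rw [mul_assoc, ← Complex.exp_add]
    push_cast
    ring_nf
  have hnorm : ∀ (k : ℤ) (ω : ℝ), ‖r k * Complex.exp (Complex.I * (m - k : ℤ) * ω)‖ = ‖r k‖ := by
    intro k ω
    rw [norm_mul, Complex.norm_exp]
    simp
  have hlim : ∀ ω : ℝ, HasSum (fun k => r k * Complex.exp (Complex.I * (m - k : ℤ) * ω))
      ((f ω : ℂ) * Complex.exp (Complex.I * m * ω)) := by
    intro ω
    have hs : Summable fun k : ℤ => r k * Complex.exp (-Complex.I * (k : ℂ) * (ω : ℂ)) :=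
      .of_norm (by simpa only [norm_fourierTerm] using hsum)
    rw [hf]
    simpa only [hterm] using hs.hasSum.mul_right (Complex.exp (Complex.I * m * ω))
  have h := intervalIntegral.hasSum_integral_of_dominated_convergence
    (μ := MeasureTheory.volume) (a := 0) (b := 2 * Real.pi) (fun k _ => ‖r k‖)
    (fun k => Continuous.aestronglyMeasurable (by fun_prop))
    (fun k => .of_forall fun ω _ => (hnorm k ω).le)
    (.of_forall fun ω _ => hsum) (by simp)
    (.of_forall fun ω _ => hlim ω)
  simp_rw [intervalIntegral.integral_const_mul, integral_exp_I_mul_int] at h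
  refine h.unique ?_
  convert! hasSum_ite_eq m (2 * Real.pi * r m) using 2 with k
  simp only [sub_eq_zero, eq_comm (a := m)]
  split_ifs with hk
  · rw [hk]; ring
  · simp

lemma norm_trigVec_quadratic_sub_le (hsum : Summable fun k => ‖r k‖)
    (hf : ∀ ω : ℝ, (f ω : ℂ) = ∑' k : ℤ, r k * Complex.exp (-Complex.I * (k : ℂ) * (ω : ℂ)))
    {n : ℕ} {A : Matrix (Fin n) (Fin n) ℂ} (hA : ∀ i j : Fin n, A i j = r ((i : ℤ) - (j : ℤ)))
    (ω : ℝ) :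
    ‖(n : ℂ) * f ω - star (trigVec n ω) ⬝ᵥ A *ᵥ trigVec n ω‖
      ≤ ∑ i : Fin n, (normTail r i + normTail r (n - 1 - i)) := by
  have h : (n : ℂ) * f ω - star (trigVec n ω) ⬝ᵥ A *ᵥ trigVec n ω = ∑ i : Fin n,
      (∑' k : ℤ, r k * Complex.exp (-Complex.I * (k : ℂ) * (ω : ℂ)) - ∑ j : Fin n,
        r ((i : ℤ) - (j : ℤ)) *
          Complex.exp (-Complex.I * (((i : ℤ) - (j : ℤ) : ℤ) : ℂ) * (ω : ℂ))) := by
    rw [Finset.sum_sub_distrib, ← hf, Finset.sum_const, Finset.card_univ, Fintype.card_fin,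
      nsmul_eq_mul]
    congr 1
    simp only [dotProduct, mulVec, Finset.mul_sum, Pi.star_apply, star_trigVec_apply]
    refine Finset.sum_congr rfl fun i _ => Finset.sum_congr rfl fun j _ => ?_
    rw [hA, trigVec, mul_left_comm, ← Complex.exp_add]
    push_cast
    ring_nf
  rw [h]
  exact (norm_sum_le _ _).trans (Finset.sum_le_sum fun i _ =>
    norm_tsum_sub_sum_le_normTail hsum (norm_fourierTerm r ω) n i)

variable {n : ℕ} {A : Matrix (Fin n) (Fin n) ℂ}

lemma integral_symbol_mul_trigWeight_eigenvector (hsum : Summable fun k => ‖r k‖)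
    (hf : ∀ ω : ℝ, (f ω : ℂ) = ∑' k : ℤ, r k * Complex.exp (-Complex.I * (k : ℂ) * (ω : ℂ)))
    (hT : ∀ i j : Fin n, A i j = r ((i : ℤ) - (j : ℤ))) (hA : A.IsHermitian) (j : Fin n) :
    ∫ ω in (0:ℝ)..(2 * Real.pi), f ω * trigWeight (hA.eigenvectorBasis j) ω
      = 2 * Real.pi * hA.eigenvalues j := by
  have h := integral_mul_trigWeight (continuous_symbol hsum hf) (integral_symbol_mul_exp hsum hf)
    hT (hA.eigenvectorBasis j)
  rw [hA.mulVec_eigenvectorBasis, dotProduct_smul, hA.star_eigenvectorBasis_dotProduct_self] at h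
  simp only [Complex.real_smul, mul_one] at h
  exact_mod_cast h

lemma le_toeplitz_eigenvalues (hsum : Summable fun k => ‖r k‖)
    (hf : ∀ ω : ℝ, (f ω : ℂ) = ∑' k : ℤ, r k * Complex.exp (-Complex.I * (k : ℂ) * (ω : ℂ)))
    {δ : ℝ} (hδ : ∀ ω ∈ Set.Icc (0:ℝ) (2 * Real.pi), δ ≤ f ω)
    (hT : ∀ i j : Fin n, A i j = r ((i : ℤ) - (j : ℤ))) (hA : A.IsHermitian) (j : Fin n) :
    δ ≤ hA.eigenvalues j := by
  have hw := continuous_trigWeight (hA.eigenvectorBasis j)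
  have h : ∫ ω in (0:ℝ)..(2 * Real.pi), δ * trigWeight (hA.eigenvectorBasis j) ω
      ≤ ∫ ω in (0:ℝ)..(2 * Real.pi), f ω * trigWeight (hA.eigenvectorBasis j) ω :=
    intervalIntegral.integral_mono_on Real.two_pi_pos.le
      ((continuous_const.mul hw).intervalIntegrable _ _)
      (((continuous_symbol hsum hf).mul hw).intervalIntegrable _ _)
      fun ω hω => mul_le_mul_of_nonneg_right (hδ ω hω) (trigWeight_nonneg _ _)
  rw [intervalIntegral.integral_const_mul,
    integral_trigWeight (hA.star_eigenvectorBasis_dotProduct_self j),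
    integral_symbol_mul_trigWeight_eigenvector hsum hf hT hA, mul_comm] at h
  exact le_of_mul_le_mul_left h Real.two_pi_pos

lemma sum_trigWeight_eigenvectorBasis (hA : A.IsHermitian) (ω : ℝ) :
    ∑ j, trigWeight (hA.eigenvectorBasis j) ω = n := by
  have h := hA.star_dotProduct_self_eq_sum (trigVec n ω)
  rw [star_dotProduct_trigVec_self] at h
  exact_mod_cast h.symm

lemma log_le_log_add_div_sub_one {x y : ℝ} (hx : 0 < x) (hy : 0 < y) :
    Real.log x ≤ Real.log y + x / y - 1 := by
  have h := Real.log_le_sub_one_of_pos (div_pos hx hy)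
  rw [Real.log_div hx.ne' hy.ne'] at h
  linarith

lemma continuousOn_log_symbol (hsum : Summable fun k => ‖r k‖)
    (hf : ∀ ω : ℝ, (f ω : ℂ) = ∑' k : ℤ, r k * Complex.exp (-Complex.I * (k : ℂ) * (ω : ℂ)))
    {δ : ℝ} (hδ0 : 0 < δ) (hδ : ∀ ω ∈ Set.Icc (0:ℝ) (2 * Real.pi), δ ≤ f ω) :
    ContinuousOn (fun ω => Real.log (f ω)) (Set.uIcc (0:ℝ) (2 * Real.pi)) := by
  rw [Set.uIcc_of_le Real.two_pi_pos.le]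
  exact (continuous_symbol hsum hf).continuousOn.log fun ω hω => (hδ0.trans_le (hδ ω hω)).ne'

lemma integral_log_symbol_le_sum_log_eigenvalues (hsum : Summable fun k => ‖r k‖)
    (hf : ∀ ω : ℝ, (f ω : ℂ) = ∑' k : ℤ, r k * Complex.exp (-Complex.I * (k : ℂ) * (ω : ℂ)))
    {δ : ℝ} (hδ0 : 0 < δ) (hδ : ∀ ω ∈ Set.Icc (0:ℝ) (2 * Real.pi), δ ≤ f ω)
    (hT : ∀ i j : Fin n, A i j = r ((i : ℤ) - (j : ℤ))) (hA : A.IsHermitian) :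
    n * ∫ ω in (0:ℝ)..(2 * Real.pi), Real.log (f ω)
      ≤ 2 * Real.pi * ∑ j, Real.log (hA.eigenvalues j) := by
  have hw := fun j => continuous_trigWeight (hA.eigenvectorBasis j)
  have hlog := continuousOn_log_symbol hsum hf hδ0 hδ
  have hint : ∀ j, IntervalIntegrable
      (fun ω => Real.log (f ω) * trigWeight (hA.eigenvectorBasis j) ω)
      MeasureTheory.volume 0 (2 * Real.pi) :=
    fun j => (hlog.mul (hw j).continuousOn).intervalIntegrable
  have hsplit : n * ∫ ω in (0:ℝ)..(2 * Real.pi), Real.log (f ω) = ∑ j,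
      ∫ ω in (0:ℝ)..(2 * Real.pi), Real.log (f ω) * trigWeight (hA.eigenvectorBasis j) ω := by
    rw [← intervalIntegral.integral_finsetSum fun j _ => hint j,
      ← intervalIntegral.integral_const_mul]
    simp_rw [← Finset.mul_sum, sum_trigWeight_eigenvectorBasis hA, mul_comm]
  rw [hsplit, Finset.mul_sum]
  refine Finset.sum_le_sum fun j _ => ?_
  set l := hA.eigenvalues j with hl
  have hlpos : 0 < l := hδ0.trans_le (le_toeplitz_eigenvalues hsum hf hδ hT hA j)
  have hfw : IntervalIntegrable (fun ω => l⁻¹ * (f ω * trigWeight (hA.eigenvectorBasis j) ω))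
      MeasureTheory.volume 0 (2 * Real.pi) :=
    (continuous_const.mul ((continuous_symbol hsum hf).mul (hw j))).intervalIntegrable _ _
  have hcw : IntervalIntegrable
      (fun ω => (Real.log l - 1) * trigWeight (hA.eigenvectorBasis j) ω)
      MeasureTheory.volume 0 (2 * Real.pi) :=
    (continuous_const.mul (hw j)).intervalIntegrable _ _
  calc _ ≤ ∫ ω in (0:ℝ)..(2 * Real.pi),
        ((Real.log l - 1) * trigWeight (hA.eigenvectorBasis j) ω
          + l⁻¹ * (f ω * trigWeight (hA.eigenvectorBasis j) ω)) := by
        refine intervalIntegral.integral_mono_on Real.two_pi_pos.le (hint j) (hcw.add hfw)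
          fun ω hω => ?_
        have h := mul_le_mul_of_nonneg_right
          (log_le_log_add_div_sub_one (hδ0.trans_le (hδ ω hω)) hlpos)
          (trigWeight_nonneg (hA.eigenvectorBasis j) ω)
        refine h.trans (le_of_eq ?_)
        ring
    _ = 2 * Real.pi * Real.log l := by
        rw [intervalIntegral.integral_add hcw hfw, intervalIntegral.integral_const_mul,
          intervalIntegral.integral_const_mul,
          integral_trigWeight (hA.star_eigenvectorBasis_dotProduct_self j),
          integral_symbol_mul_trigWeight_eigenvector hsum hf hT hA, ← hl]
        field_simp
        ring

lemma sum_log_eigenvalues_le_integral_log_symbol (hsum : Summable fun k => ‖r k‖)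
    (hf : ∀ ω : ℝ, (f ω : ℂ) = ∑' k : ℤ, r k * Complex.exp (-Complex.I * (k : ℂ) * (ω : ℂ)))
    {δ : ℝ} (hδ0 : 0 < δ) (hδ : ∀ ω ∈ Set.Icc (0:ℝ) (2 * Real.pi), δ ≤ f ω)
    (hT : ∀ i j : Fin n, A i j = r ((i : ℤ) - (j : ℤ))) (hA : A.IsHermitian) :
    2 * Real.pi * ∑ j, Real.log (hA.eigenvalues j)
      ≤ n * (∫ ω in (0:ℝ)..(2 * Real.pi), Real.log (f ω))
        + 2 * Real.pi * ((∑ i : Fin n, (normTail r i + normTail r (n - 1 - i))) / δ) := by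
  set E := ∑ i : Fin n, (normTail r i + normTail r (n - 1 - i)) with hE
  have hw := fun j => continuous_trigWeight (hA.eigenvectorBasis j)
  have hint : ∀ j, IntervalIntegrable
      (fun ω => Real.log (hA.eigenvalues j) * trigWeight (hA.eigenvectorBasis j) ω)
      MeasureTheory.volume 0 (2 * Real.pi) :=
    fun j => (continuous_const.mul (hw j)).intervalIntegrable _ _
  have hlog : IntervalIntegrable (fun ω => n * Real.log (f ω))
      MeasureTheory.volume 0 (2 * Real.pi) :=
    (continuousOn_log_symbol hsum hf hδ0 hδ).intervalIntegrable.const_mul _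
  have hpt : ∀ ω ∈ Set.Icc (0:ℝ) (2 * Real.pi),
      ∑ j, Real.log (hA.eigenvalues j) * trigWeight (hA.eigenvectorBasis j) ω
        ≤ n * Real.log (f ω) + E / δ := by
    intro ω hω
    have hfpos : 0 < f ω := hδ0.trans_le (hδ ω hω)
    set q := ∑ j, hA.eigenvalues j * trigWeight (hA.eigenvectorBasis j) ω with hq
    have hqE : |n * f ω - q| ≤ E := by
      have h := norm_trigVec_quadratic_sub_le hsum hf hT ω
      rw [hA.star_dotProduct_mulVec_eq_sum] at h
      change ‖(n : ℂ) * f ω - (q : ℂ)‖ ≤ E at h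
      rw [← Real.norm_eq_abs, ← Complex.norm_real]
      exact_mod_cast h
    have hE0 : 0 ≤ E := (abs_nonneg _).trans hqE
    calc _ ≤ ∑ j, (Real.log (f ω) + hA.eigenvalues j / f ω - 1)
            * trigWeight (hA.eigenvectorBasis j) ω :=
          Finset.sum_le_sum fun j _ => mul_le_mul_of_nonneg_right
            (log_le_log_add_div_sub_one
              (hδ0.trans_le (le_toeplitz_eigenvalues hsum hf hδ hT hA j)) hfpos)
            (trigWeight_nonneg _ _)
      _ = (Real.log (f ω) - 1) * ∑ j, trigWeight (hA.eigenvectorBasis j) ω + q / f ω := by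
          rw [hq, Finset.mul_sum, Finset.sum_div, ← Finset.sum_add_distrib]
          exact Finset.sum_congr rfl fun j _ => by ring
      _ = n * Real.log (f ω) + (q - n * f ω) / f ω := by
          rw [sum_trigWeight_eigenvectorBasis hA]
          field_simp
          ring
      _ ≤ n * Real.log (f ω) + E / δ := by
          gcongr
          · linarith [(abs_le.1 hqE).1]
          · exact hδ ω hω
  calc _ = ∫ ω in (0:ℝ)..(2 * Real.pi),
        ∑ j, Real.log (hA.eigenvalues j) * trigWeight (hA.eigenvectorBasis j) ω := by
        rw [intervalIntegral.integral_finsetSum fun j _ => hint j, Finset.mul_sum]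
        refine Finset.sum_congr rfl fun j _ => ?_
        rw [intervalIntegral.integral_const_mul,
          integral_trigWeight (hA.star_eigenvectorBasis_dotProduct_self j), mul_comm]
    _ ≤ ∫ ω in (0:ℝ)..(2 * Real.pi), (n * Real.log (f ω) + E / δ) :=
        intervalIntegral.integral_mono_on Real.two_pi_pos.le
          (Continuous.intervalIntegrable
            (continuous_finsetSum _ fun j _ => continuous_const.mul (hw j)) _ _)
          (hlog.add intervalIntegrable_const) hpt
    _ = _ := by
        rw [intervalIntegral.integral_add hlog intervalIntegrable_const,
          intervalIntegral.integral_const_mul, intervalIntegral.integral_const, sub_zero,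
          smul_eq_mul]

end Symbol

/-- Log-determinant (first Szegő limit) form of the Toeplitz distribution theorem:
if the spectrum `f` is bounded below by some `δ > 0`, then the Hermitian Toeplitz
matrices are positive definite and the per-dimension log-determinant converges to
the integral of `log f`. -/
theorem toeplitz_log_det_limit
    (r : ℤ → ℂ) (hsum : Summable fun k => ‖r k‖)
    (hconj : ∀ k : ℤ, r (-k) = starRingEnd ℂ (r k))
    (f : ℝ → ℝ)
    (hf : ∀ ω : ℝ, (f ω : ℂ) = ∑' k : ℤ, r k * Complex.exp (-Complex.I * (k : ℂ) * (ω : ℂ)))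
    (hδ : ∃ δ : ℝ, 0 < δ ∧ ∀ ω ∈ Set.Icc (0:ℝ) (2 * Real.pi), δ ≤ f ω)
    (T : (n : ℕ) → Matrix (Fin n) (Fin n) ℂ)
    (hT : ∀ (n : ℕ) (i j : Fin n), T n i j = r ((i : ℤ) - (j : ℤ))) :
    (∀ n : ℕ, (T n).PosDef) ∧
    Tendsto
      (fun n : ℕ => (1 / (n : ℝ)) * Real.log ((T n).det.re))
      atTop
      (nhds ((1 / (2 * Real.pi)) * ∫ ω in (0:ℝ)..(2 * Real.pi), Real.log (f ω))) := by
  obtain ⟨δ, hδ0, hδ⟩ := hδ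
  have hA : ∀ n, (T n).IsHermitian := by
    intro n
    ext i j
    rw [conjTranspose_apply, hT, hT, ← neg_sub, hconj, Complex.star_def, Complex.conj_conj]
  have hpos : ∀ n j, 0 < (hA n).eigenvalues j := fun n j =>
    hδ0.trans_le (le_toeplitz_eigenvalues hsum hf hδ (hT n) (hA n) j)
  refine ⟨fun n => (hA n).posDef_iff_eigenvalues_pos.2 (hpos n), ?_⟩
  have hlogdet : ∀ n, Real.log (T n).det.re = ∑ j, Real.log ((hA n).eigenvalues j) := by
    intro n
    have h : (T n).det = ((∏ j, (hA n).eigenvalues j : ℝ) : ℂ) := by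
      rw [(hA n).det_eq_prod_eigenvalues]
      push_cast
      rfl
    rw [h, Complex.ofReal_re, Real.log_prod fun j _ => (hpos n j).ne']
  simp_rw [hlogdet]
  have hup := ((tendsto_normTail_average hsum).div_const δ).const_add
    ((1 / (2 * Real.pi)) * ∫ ω in (0:ℝ)..(2 * Real.pi), Real.log (f ω))
  rw [zero_div, add_zero] at hup
  have hpi := Real.two_pi_pos
  refine tendsto_of_tendsto_of_tendsto_of_le_of_le' tendsto_const_nhds hup ?_ ?_ <;>
    filter_upwards [eventually_gt_atTop 0] with n hn <;>
    have hn' : (0 : ℝ) < n := Nat.cast_pos.2 hn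
  · have h := integral_log_symbol_le_sum_log_eigenvalues hsum hf hδ0 hδ (hT n) (hA n)
    rw [one_div_mul_eq_div, one_div_mul_eq_div, div_le_div_iff₀ hpi hn']
    linarith
  · have h := sum_log_eigenvalues_le_integral_log_symbol hsum hf hδ0 hδ (hT n) (hA n)
    refine le_of_mul_le_mul_left ?_ (mul_pos hpi hn')
    convert! h using 1 <;> field_simp
end
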